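/- For every integer B ≥ 2 and every real ε > 0, consider the 2B packets of the instance I(B,ε) released at time 1, namely q_1, …, q_B and p_1, …, p_B. The set {p_1, …, p_B} is B-feasible with total value (1+ε)B, and every other B-feasible subset of {q_1, …, q_B, p_1, …, p_B} has total value strictly less than (1+ε)B; that is, {p_1, …, p_B} is the unique optimal provisional schedule for the packets pending at time 1. -/

import Mathlib

attribute [local instance] Classical.propDecidable

structure Packet where
  r : ℕ
  d : ℕ
  v : ℝ

noncomputable def totalValue (S : Finset Packet) : ℝ := ∑ p ∈ S, p.v

def Feasible (B : ℕ) (S : Finset Packet) : Prop :=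
  ∃ σ : Packet → ℕ, Set.InjOn σ ↑S ∧ (∀ p ∈ S, p.r ≤ σ p ∧ σ p ≤ p.d) ∧
    ∀ t : ℕ, (S.filter fun p => p.r ≤ t ∧ t ≤ σ p).card ≤ B

/-- The packet `q_i`: release time 1, deadline `B + i`, value 1. -/
def qpkt (B i : ℕ) : Packet := ⟨1, B + i, 1⟩

/-- The packet `p_i`: release time 1, deadline `i`, value `1 + ε`. -/
noncomputable def ppkt (ε : ℝ) (i : ℕ) : Packet := ⟨1, i, 1 + ε⟩

theorem Feasible.card_le {B : ℕ} {S : Finset Packet} (hS : Feasible B S) {t : ℕ}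
    (hr : ∀ p ∈ S, p.r = t) : S.card ≤ B := by
  obtain ⟨σ, -, hσ, hbuf⟩ := hS
  have h := hbuf t
  rwa [Finset.filter_true_of_mem
    fun p hp => ⟨(hr p hp).le, (hr p hp).symm.le.trans (hσ p hp).1⟩] at h

theorem ppkt_injective (ε : ℝ) : Function.Injective (ppkt ε) :=
  fun _ _ h => congrArg Packet.d h

theorem card_image_ppkt (B : ℕ) (ε : ℝ) : ((Finset.Icc 1 B).image (ppkt ε)).card = B := by
  simp [Finset.card_image_of_injective _ (ppkt_injective ε)]

theorem feasible_image_ppkt (B : ℕ) (ε : ℝ) : Feasible B ((Finset.Icc 1 B).image (ppkt ε)) := by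
  refine ⟨Packet.d, ?_, ?_, fun t => ?_⟩
  · intro p hp q hq h
    simp only [Finset.coe_image, Set.mem_image, Finset.mem_coe] at hp hq
    obtain ⟨i, -, rfl⟩ := hp
    obtain ⟨j, -, rfl⟩ := hq
    exact congrArg (ppkt ε) h
  · intro p hp
    obtain ⟨i, hi, rfl⟩ := Finset.mem_image.1 hp
    exact ⟨(Finset.mem_Icc.1 hi).1, le_rfl⟩
  · exact (Finset.card_filter_le _ _).trans (card_image_ppkt B ε).le

theorem totalValue_image_ppkt (B : ℕ) (ε : ℝ) :
    totalValue ((Finset.Icc 1 B).image (ppkt ε)) = (1 + ε) * B := by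
  rw [totalValue, Finset.sum_image (ppkt_injective ε).injOn]
  simp only [ppkt, Finset.sum_const, Nat.card_Icc, Nat.add_sub_cancel, nsmul_eq_mul, mul_comm]

theorem unique_optimal_provisional (B : ℕ) (hB : 2 ≤ B) (ε : ℝ) (hε : 0 < ε) :
    -- the packets of I(B,ε) pending at time 1
    let pending : Finset Packet :=
      (Finset.Icc 1 B).image (qpkt B) ∪ (Finset.Icc 1 B).image (ppkt ε)
    let Popt : Finset Packet := (Finset.Icc 1 B).image (ppkt ε)
    -- {p_1, …, p_B} is B-feasible with total value (1+ε)B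
    Popt ⊆ pending ∧ Feasible B Popt ∧ totalValue Popt = (1 + ε) * B ∧
    -- and every other B-feasible subset of the pending packets has strictly
    -- smaller total value
    ∀ S ⊆ pending, Feasible B S → S ≠ Popt → totalValue S < (1 + ε) * B := by
  intro pending Popt
  refine ⟨Finset.subset_union_right, feasible_image_ppkt B ε, totalValue_image_ppkt B ε, ?_⟩
  intro S hS hfeas hne
  have hpkt : ∀ p ∈ S, p.r = 1 ∧ p.v ≤ 1 + ε ∧ (p ∉ Popt → p.v < 1 + ε) := by
    intro p hp
    rcases Finset.mem_union.1 (hS hp) with h | h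
    · obtain ⟨i, -, rfl⟩ := Finset.mem_image.1 h
      have hlt : (qpkt B i).v < 1 + ε := lt_add_of_pos_right 1 hε
      exact ⟨rfl, hlt.le, fun _ => hlt⟩
    · obtain ⟨i, -, rfl⟩ := Finset.mem_image.1 h
      exact ⟨rfl, le_rfl, fun hn => absurd h hn⟩
  have hpos : 0 < 1 + ε := by linarith
  have hsum : ∑ _p ∈ S, (1 + ε) = (1 + ε) * S.card := by
    rw [Finset.sum_const, nsmul_eq_mul, mul_comm]
  by_cases hsub : S ⊆ Popt
  · have hcard : S.card < B :=
      (Finset.card_lt_card (hsub.ssubset_of_ne hne)).trans_eq (card_image_ppkt B ε)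
    calc totalValue S ≤ ∑ _p ∈ S, (1 + ε) := Finset.sum_le_sum fun p hp => (hpkt p hp).2.1
      _ = (1 + ε) * S.card := hsum
      _ < (1 + ε) * B := by gcongr
  · obtain ⟨p, hp, hpn⟩ := Finset.not_subset.1 hsub
    have hcard : S.card ≤ B := hfeas.card_le fun p hp => (hpkt p hp).1
    calc totalValue S < ∑ _p ∈ S, (1 + ε) :=
          Finset.sum_lt_sum (fun p hp => (hpkt p hp).2.1) ⟨p, hp, (hpkt p hp).2.2 hpn⟩
      _ = (1 + ε) * S.card := hsum
      _ ≤ (1 + ε) * B := by gcongr
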